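/- arXiv:2005.06672 — 5 statements merged into one kernel-verified Lean document; each statement's English description precedes it below -/
import Mathlib

section
/- Let E be the Euclidean space ℝ² (EuclideanSpace ℝ (Fin 2)), let a, b ∈ E, and let p ≥ 1 be a real number. Then 2^(1−p) · ‖a − b‖^p is the least element of the set { ‖a − m‖^p + ‖m − b‖^p : m ∈ E }, and it is attained at the midpoint m = (a + b)/2. -/
theorem norm_sub_midpoint_rpow_add {V : Type*} [SeminormedAddCommGroup V] [NormedSpace ℝ V]
    (a b : V) (p : ℝ) :
    ‖a - midpoint ℝ a b‖ ^ p + ‖midpoint ℝ a b - b‖ ^ p = 2 ^ (1 - p) * ‖a - b‖ ^ p := by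
  rw [← dist_eq_norm, ← dist_eq_norm, dist_left_midpoint, dist_midpoint_right, dist_eq_norm,
    Real.norm_ofNat, Real.mul_rpow (by positivity) (norm_nonneg _),
    Real.inv_rpow zero_le_two, Real.rpow_sub two_pos, Real.rpow_one]
  ring

theorem two_rpow_mul_norm_sub_rpow_le {V : Type*} [SeminormedAddCommGroup V] (a m b : V)
    {p : ℝ} (hp : 1 ≤ p) :
    2 ^ (1 - p) * ‖a - b‖ ^ p ≤ ‖a - m‖ ^ p + ‖m - b‖ ^ p := by
  have h_convex : (‖a - m‖ + ‖m - b‖) ^ p ≤ 2 ^ (p - 1) * (‖a - m‖ ^ p + ‖m - b‖ ^ p) :=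
    mod_cast NNReal.rpow_add_le_mul_rpow_add_rpow ‖a - m‖₊ ‖m - b‖₊ hp
  calc
    2 ^ (1 - p) * ‖a - b‖ ^ p ≤ 2 ^ (1 - p) * (‖a - m‖ + ‖m - b‖) ^ p := by
      gcongr
      exact norm_sub_le_norm_sub_add_norm_sub a m b
    _ ≤ 2 ^ (1 - p) * (2 ^ (p - 1) * (‖a - m‖ ^ p + ‖m - b‖ ^ p)) := by gcongr
    _ = ‖a - m‖ ^ p + ‖m - b‖ ^ p := by
      rw [← mul_assoc, ← Real.rpow_add two_pos, sub_add_sub_cancel, sub_self, Real.rpow_zero,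
        one_mul]

/-- For points `a b` of the Euclidean plane and real `p ≥ 1`, the value
`2^(1-p) * ‖a - b‖^p` is the least element of `{ ‖a - m‖^p + ‖m - b‖^p : m ∈ ℝ² }`,
attained at the midpoint `m = (a + b)/2`. -/
theorem pMean_point_min (a b : EuclideanSpace ℝ (Fin 2)) (p : ℝ) (hp : 1 ≤ p) :
    IsLeast {c : ℝ | ∃ m : EuclideanSpace ℝ (Fin 2), c = ‖a - m‖ ^ p + ‖m - b‖ ^ p}
      (2 ^ (1 - p) * ‖a - b‖ ^ p) ∧
    ‖a - midpoint ℝ a b‖ ^ p + ‖midpoint ℝ a b - b‖ ^ p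
      = 2 ^ (1 - p) * ‖a - b‖ ^ p := by
  exact ⟨⟨⟨midpoint ℝ a b, (norm_sub_midpoint_rpow_add a b p).symm⟩, by
    rintro _ ⟨m, rfl⟩
    exact two_rpow_mul_norm_sub_rpow_le a m b hp⟩, norm_sub_midpoint_rpow_add a b p⟩
end

section
/- Let P, Q : [0,1] → ℝ² be continuous curves, let ε ≥ 0, and let α, β : [0,1] → [0,1] be reparameterizations (continuous, non-decreasing, with α(0)=β(0)=0 and α(1)=β(1)=1) such that dist(P(α(t)), Q(β(t))) ≤ ε for all t ∈ [0,1]. Define the midpoint curve M : [0,1] → ℝ² by M(t) = midpoint(P(α(t)), Q(β(t))). Then M is continuous and satisfies d_F(P, M) ≤ ε/2 and d_F(Q, M) ≤ ε/2. -/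
/-- A reparameterization: a continuous, non-decreasing map of `[0,1]` to itself
fixing the endpoints. -/
def IsReparam (α : ℝ → ℝ) : Prop :=
  ContinuousOn α (Set.Icc 0 1) ∧ MonotoneOn α (Set.Icc 0 1) ∧
    Set.MapsTo α (Set.Icc 0 1) (Set.Icc 0 1) ∧ α 0 = 0 ∧ α 1 = 1

/-- The Fréchet distance between two curves `P, Q : [0,1] → ℝ²`: the infimum over
pairs of reparameterizations of the supremum of pointwise distances. -/
noncomputable def frechetDist (P Q : ℝ → EuclideanSpace ℝ (Fin 2)) : ℝ :=
  sInf { r : ℝ | ∃ α β : ℝ → ℝ, IsReparam α ∧ IsReparam β ∧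
    r = ⨆ t : Set.Icc (0 : ℝ) 1, dist (P (α t.1)) (Q (β t.1)) }

theorem isReparam_id : IsReparam (fun t => t) :=
  ⟨continuousOn_id, monotoneOn_id, Set.mapsTo_id _, rfl, rfl⟩

/-- A matching within `r` bounds the Fréchet distance by `r`. -/
theorem frechetDist_le {P Q : ℝ → EuclideanSpace ℝ (Fin 2)} {α β : ℝ → ℝ} {r : ℝ}
    (hα : IsReparam α) (hβ : IsReparam β)
    (h : ∀ t ∈ Set.Icc (0 : ℝ) 1, dist (P (α t)) (Q (β t)) ≤ r) :
    frechetDist P Q ≤ r := by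
  have bdd : BddBelow { r : ℝ | ∃ α β : ℝ → ℝ, IsReparam α ∧ IsReparam β ∧
      r = ⨆ t : Set.Icc (0 : ℝ) 1, dist (P (α t.1)) (Q (β t.1)) } := by
    refine ⟨0, ?_⟩
    rintro _ ⟨_, _, -, -, rfl⟩
    exact Real.iSup_nonneg fun _ => dist_nonneg
  have : Nonempty (Set.Icc (0 : ℝ) 1) := ⟨⟨0, by simp⟩⟩
  exact (csInf_le bdd ⟨α, β, hα, hβ, rfl⟩).trans (ciSup_le fun t => h t.1 t.2)

/-- Given reparameterizations matching `P` and `Q` within distance `ε`, the curve of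
midpoints along the matching is continuous and within Fréchet distance `ε/2` of each
input curve. -/
theorem midpoint_curve_close (P Q : ℝ → EuclideanSpace ℝ (Fin 2))
    (hP : ContinuousOn P (Set.Icc 0 1)) (hQ : ContinuousOn Q (Set.Icc 0 1))
    (ε : ℝ) (hε : 0 ≤ ε) (α β : ℝ → ℝ) (hα : IsReparam α) (hβ : IsReparam β)
    (hmatch : ∀ t ∈ Set.Icc (0 : ℝ) 1, dist (P (α t)) (Q (β t)) ≤ ε) :
    ContinuousOn (fun t => midpoint ℝ (P (α t)) (Q (β t))) (Set.Icc 0 1) ∧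
    frechetDist P (fun t => midpoint ℝ (P (α t)) (Q (β t))) ≤ ε / 2 ∧
    frechetDist Q (fun t => midpoint ℝ (P (α t)) (Q (β t))) ≤ ε / 2 := by
  refine ⟨?_, frechetDist_le hα isReparam_id fun t ht => ?_,
    frechetDist_le hβ isReparam_id fun t ht => ?_⟩
  · have h₁ := hP.comp hα.1 hα.2.2.1
    have h₂ := hQ.comp hβ.1 hβ.2.2.1
    simp only [midpoint_eq_smul_add]
    exact (h₁.add h₂).const_smul (⅟2 : ℝ)
  · have := hmatch t ht
    rw [dist_left_midpoint, Real.norm_ofNat]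
    linarith
  · have := hmatch t ht
    rw [dist_right_midpoint, Real.norm_ofNat]
    linarith
end

section
/- Let X be a metric space, L a positive natural number, p ≥ 1 a real number, and α ≥ 0 a real number. Let P, P' : Fin L → X and M, M' ∈ X. Suppose (i) dist(P i, P' i) ≤ α · dist(P i, M) for every i (each P'_i is an α-approximate simplification, whose error is at most α times the distance from P_i to the optimum M), and (ii) ∑_i dist(P' i, M')^p ≤ ∑_i dist(P' i, M)^p (M' is an optimal p-mean for the simplified inputs P'_i). Then (∑_i dist(P i, M')^p)^(1/p) ≤ (2α + 1) · (∑_i dist(P i, M)^p)^(1/p). -/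
open Finset

theorem Lp_sum_mono {ι : Type*} (s : Finset ι) {p : ℝ} (hp : 0 ≤ p) {f g : ι → ℝ}
    (hf : ∀ i ∈ s, 0 ≤ f i) (hfg : ∀ i ∈ s, f i ≤ g i) :
    (∑ i ∈ s, f i ^ p) ^ (1 / p) ≤ (∑ i ∈ s, g i ^ p) ^ (1 / p) :=
  Real.rpow_le_rpow (sum_nonneg fun i hi => Real.rpow_nonneg (hf i hi) p)
    (sum_le_sum fun i hi => Real.rpow_le_rpow (hf i hi) (hfg i hi) hp) (by positivity)

theorem Lp_sum_const_mul {ι : Type*} (s : Finset ι) {p c : ℝ} (hp : p ≠ 0) (hc : 0 ≤ c)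
    {f : ι → ℝ} (hf : ∀ i ∈ s, 0 ≤ f i) :
    (∑ i ∈ s, (c * f i) ^ p) ^ (1 / p) = c * (∑ i ∈ s, f i ^ p) ^ (1 / p) := by
  rw [sum_congr rfl fun i hi => Real.mul_rpow hc (hf i hi), ← mul_sum,
    Real.mul_rpow (Real.rpow_nonneg hc p) (sum_nonneg fun i hi => Real.rpow_nonneg (hf i hi) p),
    one_div, Real.rpow_rpow_inv hc hp]

/-- The p-Mean Algorithm is a `(2α+1)`-approximation: if each `P' i` is an
`α`-approximate simplification of `P i` (error at most `α` times the distance from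
`P i` to the optimum `M`), and `M'` is an optimal p-mean for the simplified inputs,
then the ℓ_p cost of `M'` for the original inputs is at most `2α+1` times optimal. -/
theorem pMean_algorithm_approx {X : Type*} [MetricSpace X]
    (L : ℕ) (hL : 0 < L) (p α : ℝ) (hp : 1 ≤ p) (hα : 0 ≤ α)
    (P P' : Fin L → X) (M M' : X)
    (hsimp : ∀ i, dist (P i) (P' i) ≤ α * dist (P i) M)
    (hopt : ∑ i, dist (P' i) M' ^ p ≤ ∑ i, dist (P' i) M ^ p) :
    (∑ i, dist (P i) M' ^ p) ^ (1 / p)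
      ≤ (2 * α + 1) * (∑ i, dist (P i) M ^ p) ^ (1 / p) := by
  have hp0 : 0 < p := by linarith
  have hopt' : (∑ i, dist (P' i) M' ^ p) ^ (1 / p) ≤ (∑ i, dist (P' i) M ^ p) ^ (1 / p) :=
    Real.rpow_le_rpow (by positivity) hopt (by positivity)
  have hsimpM (i : Fin L) : dist (P' i) M ≤ (α + 1) * dist (P i) M := by
    linarith [dist_triangle_left (P' i) M (P i), hsimp i]
  calc (∑ i, dist (P i) M' ^ p) ^ (1 / p)
      ≤ (∑ i, (dist (P i) (P' i) + dist (P' i) M') ^ p) ^ (1 / p) :=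
        Lp_sum_mono _ hp0.le (fun _ _ => dist_nonneg) fun _ _ => dist_triangle _ _ _
    _ ≤ (∑ i, dist (P i) (P' i) ^ p) ^ (1 / p) + (∑ i, dist (P' i) M' ^ p) ^ (1 / p) :=
        Real.Lp_add_le_of_nonneg _ hp (fun _ _ => dist_nonneg) fun _ _ => dist_nonneg
    _ ≤ (∑ i, (α * dist (P i) M) ^ p) ^ (1 / p)
          + (∑ i, ((α + 1) * dist (P i) M) ^ p) ^ (1 / p) :=
        add_le_add (Lp_sum_mono _ hp0.le (fun _ _ => dist_nonneg) fun i _ => hsimp i)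
          (hopt'.trans (Lp_sum_mono _ hp0.le (fun _ _ => dist_nonneg) fun i _ => hsimpM i))
    _ = (2 * α + 1) * (∑ i, dist (P i) M ^ p) ^ (1 / p) := by
        rw [Lp_sum_const_mul _ hp0.ne' hα fun _ _ => dist_nonneg,
          Lp_sum_const_mul _ hp0.ne' (by positivity) fun _ _ => dist_nonneg]
        ring
end

section
/- Let X be a metric space, L a positive natural number, and p ≥ 1 a real number. Let P : Fin L → X, let O, T ∈ X, and let i be an index such that dist(T, P i) ≤ dist(O, P i). Then (∑_j dist(P j, T)^p)^(1/p) ≤ (∑_j dist(P j, O)^p)^(1/p) + 2 · L^(1/p) · dist(O, P i). -/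
open Finset

/-- Analysis of the Pairwise Algorithm: if `T` is at least as close to `P i` as `O` is,
then the ℓ_p cost of `T` exceeds that of `O` by at most `2 · L^(1/p) · dist O (P i)`. -/
theorem pairwise_algorithm_cost_bound {X : Type*} [MetricSpace X]
    (L : ℕ) (hL : 0 < L) (p : ℝ) (hp : 1 ≤ p)
    (P : Fin L → X) (O T : X) (i : Fin L)
    (hT : dist T (P i) ≤ dist O (P i)) :
    (∑ j, dist (P j) T ^ p) ^ (1 / p)
      ≤ (∑ j, dist (P j) O ^ p) ^ (1 / p) + 2 * (L : ℝ) ^ (1 / p) * dist O (P i) := by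
  have hp0 : 0 < p := zero_lt_one.trans_le hp
  have hOT : dist O T ≤ 2 * dist O (P i) := by
    have := dist_triangle_right O T (P i)
    linarith
  have hconst : (∑ _j : Fin L, (2 * dist O (P i)) ^ p) ^ (1 / p)
      = 2 * (L : ℝ) ^ (1 / p) * dist O (P i) := by
    rw [sum_const, card_univ, Fintype.card_fin, nsmul_eq_mul,
      Real.mul_rpow (by positivity) (by positivity), ← Real.rpow_mul (by positivity),
      mul_one_div_cancel hp0.ne', Real.rpow_one]
    ring
  calc (∑ j, dist (P j) T ^ p) ^ (1 / p)
      ≤ (∑ j, (dist (P j) O + 2 * dist O (P i)) ^ p) ^ (1 / p) := by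
        gcongr with j
        exact (dist_triangle (P j) O T).trans (by gcongr)
    _ ≤ (∑ j, dist (P j) O ^ p) ^ (1 / p)
          + (∑ _j : Fin L, (2 * dist O (P i)) ^ p) ^ (1 / p) :=
        Real.Lp_add_le_of_nonneg _ hp (fun _ _ => by positivity) (fun _ _ => by positivity)
    _ = _ := by rw [hconst]
end

section
/- Let X be a metric space, L a positive natural number, and p ≥ 1 a real number. Let P : Fin L → X, let Q ∈ X, and let i be an index minimizing the distance to Q, i.e., dist(Q, P i) ≤ dist(Q, P j) for all j. Then ∑_j dist(P i, P j)^p ≤ 2^p · ∑_j dist(Q, P j)^p; in particular, (∑_j dist(P i, P j)^p)^(1/p) ≤ 2 · (∑_j dist(Q, P j)^p)^(1/p), so the best input point as center is a 2-approximation to the optimal ℓ_p cost. -/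
open Finset

/-- The best input point, used as a center, is a 2-approximation to the optimal
ℓ_p cost: if `P i` is the input point closest to `Q`, then
`∑_j dist(P i, P j)^p ≤ 2^p ∑_j dist(Q, P j)^p`, and hence the ℓ_p cost of `P i`
is at most twice that of `Q`. -/
theorem best_input_center_two_approx {X : Type*} [MetricSpace X]
    (L : ℕ) (hL : 0 < L) (p : ℝ) (hp : 1 ≤ p)
    (P : Fin L → X) (Q : X) (i : Fin L)
    (hi : ∀ j, dist Q (P i) ≤ dist Q (P j)) :
    (∑ j, dist (P i) (P j) ^ p ≤ 2 ^ p * ∑ j, dist Q (P j) ^ p) ∧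
    (∑ j, dist (P i) (P j) ^ p) ^ (1 / p) ≤ 2 * (∑ j, dist Q (P j) ^ p) ^ (1 / p) := by
  have hp0 : 0 < p := one_pos.trans_le hp
  have h_pow : ∑ j, dist (P i) (P j) ^ p ≤ 2 ^ p * ∑ j, dist Q (P j) ^ p := by
    rw [mul_sum]
    refine sum_le_sum fun j _ => ?_
    rw [← Real.mul_rpow zero_le_two dist_nonneg]
    refine Real.rpow_le_rpow dist_nonneg ?_ hp0.le
    linarith [dist_triangle_left (P i) (P j) Q, hi j]
  refine ⟨h_pow, ?_⟩
  calc (∑ j, dist (P i) (P j) ^ p) ^ (1 / p)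
      ≤ (2 ^ p * ∑ j, dist Q (P j) ^ p) ^ (1 / p) :=
        Real.rpow_le_rpow (by positivity) h_pow (by positivity)
    _ = 2 * (∑ j, dist Q (P j) ^ p) ^ (1 / p) := by
        rw [Real.mul_rpow (by positivity) (by positivity), one_div,
          Real.rpow_rpow_inv zero_le_two hp0.ne']
end
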